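/- Let n ≥ 1 and 1 ≤ p ≤ 2. There exists a constant C > 0 such that for every ν ∈ ℕ₀ⁿ with ν ≠ 0, ‖φ_ν‖_{L^p(ℝⁿ)} ≤ C |ν|^{(n/2)(1/p − 1/2)}. -/

import Mathlib

open MeasureTheory Filter
open scoped ENNReal

noncomputable section

/-- Physicists' Hermite polynomial `H_k` as a real function:
`H_k(t) = (−1)^k e^{t²} (d/dt)^k e^{−t²}`. -/
def hermitePolyFun (k : ℕ) (t : ℝ) : ℝ :=
  (-1 : ℝ) ^ k * Real.exp (t ^ 2) * iteratedDeriv k (fun s => Real.exp (-s ^ 2)) t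

/-- One-dimensional Hermite function `φ_k(t) = (2^k k! √π)^{-1/2} H_k(t) e^{-t²/2}`. -/
def hermiteFun (k : ℕ) (t : ℝ) : ℝ :=
  ((2 : ℝ) ^ k * (Nat.factorial k : ℝ) * Real.sqrt Real.pi) ^ (-(1 : ℝ) / 2) *
    hermitePolyFun k t * Real.exp (-(t ^ 2) / 2)

/-- Hermite function `φ_ν` on `ℝⁿ`, `φ_ν(x) = ∏ⱼ φ_{νⱼ}(xⱼ)`. -/
def hermiteFunPi {n : ℕ} (ν : Fin n → ℕ) (x : Fin n → ℝ) : ℝ :=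
  ∏ j, hermiteFun (ν j) (x j)

/-- Fourier–Hermite coefficient `f̂(φ_ν) = ∫ f(x) φ_ν(x) dx` of a Schwartz function. -/
def hermiteCoeff {n : ℕ} (f : SchwartzMap (Fin n → ℝ) ℂ) (ν : Fin n → ℕ) : ℂ :=
  ∫ x : Fin n → ℝ, f x * (hermiteFunPi ν x : ℂ)

/-- Pseudo-multiplier associated to the harmonic oscillator:
`T_m f(x) = Σ_ν m(x,ν) f̂(φ_ν) φ_ν(x)`. -/
def pseudoMult {n : ℕ} (m : (Fin n → ℝ) → (Fin n → ℕ) → ℂ)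
    (f : SchwartzMap (Fin n → ℝ) ℂ) (x : Fin n → ℝ) : ℂ :=
  ∑' ν : Fin n → ℕ, m x ν * hermiteCoeff f ν * (hermiteFunPi ν x : ℂ)

/-- Inverse Fourier–Hermite transform `𝓕_H⁻¹ u (x) = Σ_ν u(ν) φ_ν(x)`. -/
def fhInv {n : ℕ} (u : (Fin n → ℕ) → ℂ) (x : Fin n → ℝ) : ℂ :=
  ∑' ν : Fin n → ℕ, u ν * (hermiteFunPi ν x : ℂ)

/-- Euclidean Fourier transform on `ℝⁿ` (modelled as `Fin n → ℝ`). -/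
def fourierPi {n : ℕ} (g : (Fin n → ℝ) → ℂ) (x : Fin n → ℝ) : ℂ :=
  ∫ ξ : Fin n → ℝ, Complex.exp (-(2 * Real.pi * (∑ j, x j * ξ j)) * Complex.I) * g ξ

/-- One-dimensional Fourier transform. -/
def fourier1 (g : ℝ → ℂ) (t : ℝ) : ℂ :=
  ∫ τ : ℝ, Complex.exp (-(2 * Real.pi * (t * τ)) * Complex.I) * g τ

/-- Partial derivative in the `j`-th coordinate. -/
def pderiv1 {n : ℕ} (j : Fin n) (f : (Fin n → ℝ) → ℂ) : (Fin n → ℝ) → ℂ :=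
  fun ξ => fderiv ℝ f ξ (Pi.single j 1)

/-- Multi-index partial derivative `∂^α`. -/
def pderivMulti {n : ℕ} (α : Fin n → ℕ) (f : (Fin n → ℝ) → ℂ) : (Fin n → ℝ) → ℂ :=
  (List.finRange n).foldr (fun j g => (pderiv1 j)^[α j] g) f

/-- Forward difference in the `j`-th coordinate. -/
def dDiff {n : ℕ} (j : Fin n) (g : (Fin n → ℕ) → ℂ) : (Fin n → ℕ) → ℂ :=
  fun ν => g (ν + Pi.single j 1) - g ν

/-- Multi-index forward difference `Δ^α`. -/
def dDiffMulti {n : ℕ} (α : Fin n → ℕ) (g : (Fin n → ℕ) → ℂ) : (Fin n → ℕ) → ℂ :=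
  (List.finRange n).foldr (fun j h => (dDiff j)^[α j] h) g

/-- Projection onto the `ℓ`-th Hermite eigenspace: `P_ℓ f = Σ_{|ν|=ℓ} f̂(φ_ν) φ_ν`. -/
def hermiteProj {n : ℕ} (f : SchwartzMap (Fin n → ℝ) ℂ) (ℓ : ℕ) (x : Fin n → ℝ) : ℂ :=
  ∑' ν : Fin n → ℕ, if (∑ j, ν j) = ℓ then hermiteCoeff f ν * (hermiteFunPi ν x : ℂ) else 0

/-- Spectral pseudo-multiplier `m(x,H) f(x) = Σ_ℓ m(x,ℓ) P_ℓ f(x)`. -/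
def spectralPM {n : ℕ} (m : (Fin n → ℝ) → ℝ → ℂ)
    (f : SchwartzMap (Fin n → ℝ) ℂ) (x : Fin n → ℝ) : ℂ :=
  ∑' ℓ : ℕ, m x (ℓ : ℝ) * hermiteProj f ℓ x

/-- Multilinear pseudo-multiplier. -/
def multiPM {n κ : ℕ} (m : (Fin n → ℝ) → (Fin κ → Fin n → ℕ) → ℂ)
    (f : Fin κ → SchwartzMap (Fin n → ℝ) ℂ) (x : Fin n → ℝ) : ℂ :=
  ∑' ν : Fin κ → Fin n → ℕ,
    m x ν * (∏ j, hermiteCoeff (f j) (ν j)) * ∏ j, (hermiteFunPi (ν j) x : ℂ)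

/-- Inverse Fourier–Hermite transform on `ℝ^{nκ}` (modelled as `Fin κ → Fin n → ℝ`). -/
def fhInv2 {n κ : ℕ} (u : (Fin κ → Fin n → ℕ) → ℂ) (z : Fin κ → Fin n → ℝ) : ℂ :=
  ∑' ν : Fin κ → Fin n → ℕ, u ν * ∏ j, (hermiteFunPi (ν j) (z j) : ℂ)

/-- Euclidean Fourier transform on `ℝ^{nκ}` (modelled as `Fin κ → Fin n → ℝ`). -/
def fourierPi2 {n κ : ℕ} (g : (Fin κ → Fin n → ℝ) → ℂ) (z : Fin κ → Fin n → ℝ) : ℂ :=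
  ∫ ξ : Fin κ → Fin n → ℝ,
    Complex.exp (-(2 * Real.pi * (∑ j, ∑ i, z j i * ξ j i)) * Complex.I) * g ξ

/-- The physicists' Hermite polynomials as formal polynomials. -/
def physHermite : ℕ → Polynomial ℝ
  | 0 => 1
  | k + 1 => 2 * Polynomial.X * physHermite k - Polynomial.derivative (physHermite k)

lemma derivative_physHermite_succ (k : ℕ) :
    Polynomial.derivative (physHermite (k + 1)) = 2 * ((k : Polynomial ℝ) + 1) * physHermite k := by
  induction k with
  | zero => simp [physHermite]
  | succ k ih =>
    rw [physHermite, Polynomial.derivative_sub, Polynomial.derivative_mul, ih]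
    simp only [Polynomial.derivative_mul, Polynomial.derivative_X, Polynomial.derivative_ofNat,
      Polynomial.derivative_add, Polynomial.derivative_natCast, Polynomial.derivative_one]
    conv_rhs => rw [physHermite]
    conv_lhs => rw [physHermite]
    push_cast
    ring

lemma hasDerivAt_polynomial_mul_gaussian (q : Polynomial ℝ) (t : ℝ) :
    HasDerivAt (fun s => q.eval s * Real.exp (-s ^ 2))
      ((Polynomial.derivative q - 2 * Polynomial.X * q).eval t * Real.exp (-t ^ 2)) t := by
  have h2 : HasDerivAt (fun s : ℝ => Real.exp (-s ^ 2)) (Real.exp (-t ^ 2) * (-(2 * t))) t := by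
    have h := ((hasDerivAt_pow 2 t).neg).exp
    simpa using h
  refine ((q.hasDerivAt t).mul h2).congr_deriv ?_
  simp only [Polynomial.eval_sub, Polynomial.eval_mul, Polynomial.eval_X, Polynomial.eval_ofNat]
  ring

lemma iteratedDeriv_gaussian (k : ℕ) (t : ℝ) :
    iteratedDeriv k (fun s => Real.exp (-s ^ 2)) t
      = (-1) ^ k * (physHermite k).eval t * Real.exp (-t ^ 2) := by
  induction k generalizing t with
  | zero => simp [physHermite]
  | succ k ih =>
    rw [iteratedDeriv_succ, funext ih]
    simp only [mul_assoc]
    rw [((hasDerivAt_polynomial_mul_gaussian (physHermite k) t).const_mul _).deriv]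
    simp [physHermite]
    ring

lemma hermitePolyFun_eq_eval (k : ℕ) (t : ℝ) :
    hermitePolyFun k t = (physHermite k).eval t := by
  have h1 : ((-1 : ℝ) ^ k) * (-1) ^ k = 1 := by rw [← mul_pow]; simp
  have h2 : Real.exp (t ^ 2) * Real.exp (-t ^ 2) = 1 := by rw [← Real.exp_add]; simp
  rw [hermitePolyFun, iteratedDeriv_gaussian]
  linear_combination (physHermite k).eval t * (Real.exp (t ^ 2) * Real.exp (-t ^ 2)) * h1 +
    (physHermite k).eval t * h2

lemma integrable_polynomial_mul_gaussian (q : Polynomial ℝ) :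
    Integrable (fun t : ℝ => q.eval t * Real.exp (-t ^ 2)) := by
  induction q using Polynomial.induction_on' with
  | add p q hp hq =>
    refine (hp.add hq).congr (Eventually.of_forall fun t => ?_)
    simp [add_mul]
  | monomial m a =>
    have h := integrable_rpow_mul_exp_neg_mul_sq (b := 1) one_pos (s := (m : ℝ))
      (by have : (0 : ℝ) ≤ m := m.cast_nonneg
          linarith)
    refine (h.const_mul a).congr (Eventually.of_forall fun t => ?_)
    simp [mul_assoc]

lemma integral_physHermite_sq (k : ℕ) :
    ∫ t : ℝ, (physHermite k ^ 2).eval t * Real.exp (-t ^ 2)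
      = 2 ^ k * (k.factorial : ℝ) * Real.sqrt Real.pi := by
  induction k with
  | zero => simpa [physHermite] using integral_gaussian 1
  | succ k ih =>
    have h0 := integral_eq_zero_of_hasDerivAt_of_integrable
      (hasDerivAt_polynomial_mul_gaussian (physHermite (k + 1) * physHermite k))
      (integrable_polynomial_mul_gaussian _) (integrable_polynomial_mul_gaussian _)
    have hq : Polynomial.derivative (physHermite (k + 1) * physHermite k)
        - 2 * Polynomial.X * (physHermite (k + 1) * physHermite k)
        = 2 * ((k : Polynomial ℝ) + 1) * physHermite k ^ 2 - physHermite (k + 1) ^ 2 := by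
      rw [Polynomial.derivative_mul, derivative_physHermite_succ]
      have : Polynomial.derivative (physHermite k)
        = 2 * Polynomial.X * physHermite k - physHermite (k + 1) := by rw [physHermite]; ring
      rw [this]
      ring
    rw [hq] at h0
    have h1 : ∀ t : ℝ, (2 * ((k : Polynomial ℝ) + 1) * physHermite k ^ 2
          - physHermite (k + 1) ^ 2).eval t * Real.exp (-t ^ 2)
        = 2 * ((k : ℝ) + 1) * ((physHermite k ^ 2).eval t * Real.exp (-t ^ 2))
          - (physHermite (k + 1) ^ 2).eval t * Real.exp (-t ^ 2) := by
      intro t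
      simp
      ring
    simp_rw [h1] at h0
    rw [integral_sub ((integrable_polynomial_mul_gaussian _).const_mul _)
      (integrable_polynomial_mul_gaussian _), integral_const_mul, ih] at h0
    rw [Nat.factorial_succ]
    push_cast
    linear_combination -h0

lemma integral_derivative_physHermite_sq (k : ℕ) :
    ∫ t : ℝ, (Polynomial.derivative (physHermite k) ^ 2).eval t * Real.exp (-t ^ 2)
      = 2 * k * (2 ^ k * (k.factorial : ℝ) * Real.sqrt Real.pi) := by
  cases k with
  | zero => simp [physHermite]
  | succ k =>
    have h1 : ∀ t : ℝ, (Polynomial.derivative (physHermite (k + 1)) ^ 2).eval t * Real.exp (-t ^ 2)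
        = (2 * ((k : ℝ) + 1)) ^ 2 * ((physHermite k ^ 2).eval t * Real.exp (-t ^ 2)) := by
      intro t
      rw [derivative_physHermite_succ]
      simp
      ring
    simp_rw [h1]
    rw [integral_const_mul, integral_physHermite_sq, Nat.factorial_succ]
    push_cast
    ring

lemma integral_sq_mul_physHermite_sq_le (k : ℕ) :
    ∫ t : ℝ, ((Polynomial.X * physHermite k) ^ 2).eval t * Real.exp (-t ^ 2)
      ≤ (2 * k + 1) * (2 ^ k * (k.factorial : ℝ) * Real.sqrt Real.pi) := by
  have h : ∀ t : ℝ, ((Polynomial.X * physHermite k) ^ 2).eval t * Real.exp (-t ^ 2)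
      ≤ (1 / 2 : ℝ) * ((physHermite (k + 1) ^ 2).eval t * Real.exp (-t ^ 2)
        + (Polynomial.derivative (physHermite k) ^ 2).eval t * Real.exp (-t ^ 2)) := by
    intro t
    rw [← add_mul, ← mul_assoc]
    refine mul_le_mul_of_nonneg_right ?_ (Real.exp_pos _).le
    simp only [physHermite, Polynomial.eval_pow, Polynomial.eval_mul, Polynomial.eval_X,
      Polynomial.eval_sub, Polynomial.eval_ofNat]
    nlinarith [sq_nonneg (t * (physHermite k).eval t
      - (Polynomial.derivative (physHermite k)).eval t)]
  refine (integral_mono (integrable_polynomial_mul_gaussian _)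
    (((integrable_polynomial_mul_gaussian _).add
      (integrable_polynomial_mul_gaussian _)).const_mul _) h).trans_eq ?_
  rw [integral_const_mul, integral_add' (integrable_polynomial_mul_gaussian _)
    (integrable_polynomial_mul_gaussian _), integral_physHermite_sq,
    integral_derivative_physHermite_sq, Nat.factorial_succ]
  push_cast
  ring

lemma hermiteFun_sq (k : ℕ) (t : ℝ) :
    hermiteFun k t ^ 2 = (2 ^ k * (k.factorial : ℝ) * Real.sqrt Real.pi)⁻¹ *
      ((physHermite k ^ 2).eval t * Real.exp (-t ^ 2)) := by
  have hc : (0 : ℝ) < 2 ^ k * (k.factorial : ℝ) * Real.sqrt Real.pi := by positivity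
  rw [hermiteFun, hermitePolyFun_eq_eval, mul_pow, mul_pow, ← Real.rpow_natCast _ 2,
    ← Real.rpow_mul hc.le, ← Real.exp_nat_mul, Polynomial.eval_pow]
  norm_num [Real.rpow_neg_one]
  rw [show 2 * (-t ^ 2 / 2) = -t ^ 2 by ring]
  ring

lemma continuous_hermiteFun (k : ℕ) : Continuous (hermiteFun k) := by
  unfold hermiteFun
  simp_rw [hermitePolyFun_eq_eval]
  fun_prop

lemma integrable_hermiteFun_sq (k : ℕ) : Integrable (fun t => hermiteFun k t ^ 2) := by
  simp_rw [hermiteFun_sq]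
  exact (integrable_polynomial_mul_gaussian _).const_mul _

lemma integral_hermiteFun_sq (k : ℕ) : ∫ t, hermiteFun k t ^ 2 = 1 := by
  have hc : (2 ^ k * (k.factorial : ℝ) * Real.sqrt Real.pi) ≠ 0 := by positivity
  simp_rw [hermiteFun_sq]
  rw [integral_const_mul, integral_physHermite_sq, inv_mul_cancel₀ hc]

lemma sq_mul_hermiteFun_sq (k : ℕ) (t : ℝ) :
    t ^ 2 * hermiteFun k t ^ 2 = (2 ^ k * (k.factorial : ℝ) * Real.sqrt Real.pi)⁻¹ *
      (((Polynomial.X * physHermite k) ^ 2).eval t * Real.exp (-t ^ 2)) := by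
  rw [hermiteFun_sq]
  simp
  ring

lemma integrable_sq_mul_hermiteFun_sq (k : ℕ) :
    Integrable (fun t => t ^ 2 * hermiteFun k t ^ 2) := by
  simp_rw [sq_mul_hermiteFun_sq]
  exact (integrable_polynomial_mul_gaussian _).const_mul _

lemma integral_sq_mul_hermiteFun_sq_le (k : ℕ) :
    ∫ t, t ^ 2 * hermiteFun k t ^ 2 ≤ 2 * k + 1 := by
  have hc : 0 < (2 ^ k * (k.factorial : ℝ) * Real.sqrt Real.pi) := by positivity
  simp_rw [sq_mul_hermiteFun_sq]
  rw [integral_const_mul, inv_mul_le_iff₀ hc, mul_comm _ (2 * (k : ℝ) + 1)]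
  exact integral_sq_mul_physHermite_sq_le k

/-- The `L¹` bound for one-dimensional Hermite functions, obtained by comparing `|φ_k|` with its
weighted square and an integrable weight at scale `√(2k+1)`. -/
lemma integrable_abs_hermiteFun_and_integral_le (k : ℕ) :
    Integrable (fun t => |hermiteFun k t|) ∧
      ∫ t, |hermiteFun k t| ≤ 3 * (2 * k + 1 : ℝ) ^ (1 / 4 : ℝ) := by
  set a : ℝ := 2 * k + 1 with ha
  have ha0 : 0 < a := by positivity
  set c : ℝ := a ^ (1 / 4 : ℝ) with hcdef
  have hc : 0 < c := by positivity
  have hc4 : c ^ 4 = a := by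
    rw [hcdef, ← Real.rpow_natCast, ← Real.rpow_mul ha0.le]
    norm_num
  have hpt : ∀ t : ℝ, |hermiteFun k t| ≤
      (c / 2 * hermiteFun k t ^ 2 + c / (2 * a) * (t ^ 2 * hermiteFun k t ^ 2))
        + 1 / (2 * c) * (1 + (t / c ^ 2) ^ 2)⁻¹ := by
    intro t
    set y := hermiteFun k t
    have hw : 0 < 1 + (t / c ^ 2) ^ 2 := by positivity
    set w := 1 + (t / c ^ 2) ^ 2 with hwdef
    have e : (c / 2 * y ^ 2 + c / (2 * a) * (t ^ 2 * y ^ 2)) + 1 / (2 * c) * w⁻¹ - |y|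
        = (c * |y| * w - 1) ^ 2 / (2 * c * w) := by
      have e1 : c / 2 * y ^ 2 + c / (2 * a) * (t ^ 2 * y ^ 2) = c / 2 * |y| ^ 2 * w := by
        rw [hwdef, ← hc4, sq_abs]
        field_simp
      rw [e1]
      field_simp
      ring
    have : 0 ≤ (c * |y| * w - 1) ^ 2 / (2 * c * w) := by positivity
    linarith
  have hc2 : c ^ 2 ≠ 0 := by positivity
  have i1 := (integrable_hermiteFun_sq k).const_mul (c / 2)
  have i2 := (integrable_sq_mul_hermiteFun_sq k).const_mul (c / (2 * a))
  have i3 := (integrable_inv_one_add_sq.comp_div hc2).const_mul (1 / (2 * c))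
  have hint : Integrable (fun t => |hermiteFun k t|) :=
    ((i1.add i2).add i3).mono' (continuous_hermiteFun k).abs.aestronglyMeasurable
      (Eventually.of_forall fun t => by simpa using hpt t)
  refine ⟨hint, (integral_mono hint ((i1.add i2).add i3) hpt).trans ?_⟩
  rw [integral_add' (i1.add i2) i3, integral_add' i1 i2, integral_const_mul, integral_const_mul,
    integral_const_mul, integral_hermiteFun_sq,
    Measure.integral_comp_div (fun t : ℝ => (1 + t ^ 2)⁻¹), integral_univ_inv_one_add_sq,
    abs_of_pos (by positivity : 0 < c ^ 2), smul_eq_mul]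
  have h2 : c / (2 * a) * ∫ t, t ^ 2 * hermiteFun k t ^ 2 ≤ c / (2 * a) * a :=
    mul_le_mul_of_nonneg_left (integral_sq_mul_hermiteFun_sq_le k) (by positivity)
  have h3 : c / (2 * a) * a = c / 2 := by field_simp
  have h4 : 1 / (2 * c) * (c ^ 2 * Real.pi) = c * Real.pi / 2 := by field_simp
  rw [h4]
  nlinarith [Real.pi_le_four]

lemma continuous_hermiteFunPi {n : ℕ} (ν : Fin n → ℕ) : Continuous (hermiteFunPi ν) :=
  continuous_finsetProd _ fun j _ => (continuous_hermiteFun (ν j)).comp (continuous_apply j)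

lemma integrable_abs_hermiteFunPi {n : ℕ} (ν : Fin n → ℕ) :
    Integrable (fun x => |hermiteFunPi ν x|) := by
  simp only [hermiteFunPi, Finset.abs_prod]
  exact Integrable.fintype_prod (f := fun j t => |hermiteFun (ν j) t|)
    fun j => (integrable_abs_hermiteFun_and_integral_le (ν j)).1

lemma integrable_hermiteFunPi_sq {n : ℕ} (ν : Fin n → ℕ) :
    Integrable (fun x => hermiteFunPi ν x ^ 2) := by
  simp only [hermiteFunPi, ← Finset.prod_pow]
  exact Integrable.fintype_prod (f := fun j t => hermiteFun (ν j) t ^ 2)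
    fun j => integrable_hermiteFun_sq (ν j)

lemma integral_hermiteFunPi_sq {n : ℕ} (ν : Fin n → ℕ) : ∫ x, hermiteFunPi ν x ^ 2 = 1 := by
  simp only [hermiteFunPi, ← Finset.prod_pow]
  rw [integral_fintype_prod_volume_eq_prod (fun j t => hermiteFun (ν j) t ^ 2)]
  simp [integral_hermiteFun_sq]

lemma integral_abs_hermiteFunPi_le {n : ℕ} (ν : Fin n → ℕ) :
    ∫ x, |hermiteFunPi ν x| ≤ ∏ j, 3 * (2 * (ν j) + 1 : ℝ) ^ (1 / 4 : ℝ) := by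
  simp only [hermiteFunPi, Finset.abs_prod]
  rw [integral_fintype_prod_volume_eq_prod (fun j t => |hermiteFun (ν j) t|)]
  exact Finset.prod_le_prod (fun j _ => integral_nonneg fun t => abs_nonneg _)
    fun j _ => (integrable_abs_hermiteFun_and_integral_le (ν j)).2

lemma rpow_le_mul_add_sq_mul {y s p : ℝ} (hy : 0 ≤ y) (hs : 0 < s) (hp1 : 1 ≤ p) (hp2 : p ≤ 2) :
    y ^ p ≤ s ^ (p - 1) * y + s ^ (p - 2) * y ^ 2 := by
  rcases hy.eq_or_lt with rfl | hy
  · simp [Real.zero_rpow (by linarith : p ≠ 0)]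
  have e1 : y ^ p = y ^ (p - 1) * y := by
    rw [← Real.rpow_add_one hy.ne']; ring_nf
  have e2 : y ^ p = y ^ (p - 2) * y ^ 2 := by
    rw [← Real.rpow_natCast, ← Real.rpow_add hy]; norm_num
  have p1 : 0 ≤ s ^ (p - 1) * y := by positivity
  have p2 : 0 ≤ s ^ (p - 2) * y ^ 2 := by positivity
  rcases le_total y s with h | h
  · have := mul_le_mul_of_nonneg_right
      (Real.rpow_le_rpow hy.le h (by linarith : 0 ≤ p - 1)) hy.le
    linarith
  · have := mul_le_mul_of_nonneg_right
      (Real.rpow_le_rpow_of_nonpos hs h (by linarith : p - 2 ≤ 0)) (sq_nonneg y)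
    linarith

/-- Interpolation between `L¹` and `L²`, up to the constant `2^{1/p}`, for functions that are
normalized in `L²`. -/
lemma eLpNorm_le_of_integral_abs_le {α : Type*} [MeasurableSpace α] {μ : Measure α} {f : α → ℝ}
    {A p : ℝ} (hp1 : 1 ≤ p) (hp2 : p ≤ 2) (hf : AEStronglyMeasurable f μ)
    (h1 : Integrable (fun x => |f x|) μ) (h2 : Integrable (fun x => f x ^ 2) μ)
    (hA : 0 < A) (hle : ∫ x, |f x| ∂μ ≤ A) (hsq : ∫ x, f x ^ 2 ∂μ ≤ 1) :
    eLpNorm f (ENNReal.ofReal p) μ ≤ ENNReal.ofReal (2 ^ (1 / p) * A ^ (2 / p - 1)) := by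
  have hp0 : 0 < p := by linarith
  have hpt : ∀ x, |f x| ^ p ≤ A⁻¹ ^ (p - 1) * |f x| + A⁻¹ ^ (p - 2) * f x ^ 2 := fun x => by
    simpa using rpow_le_mul_add_sq_mul (abs_nonneg (f x)) (inv_pos.2 hA) hp1 hp2
  have hb := (h1.const_mul (A⁻¹ ^ (p - 1))).add (h2.const_mul (A⁻¹ ^ (p - 2)))
  have hint : Integrable (fun x => |f x| ^ p) μ := by
    refine hb.mono' (hf.norm.aemeasurable.pow_const p).aestronglyMeasurable
      (Eventually.of_forall fun x => ?_)
    rw [Real.norm_of_nonneg (by positivity)]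
    exact hpt x
  have hI : ∫ x, |f x| ^ p ∂μ ≤ 2 * A ^ (2 - p) := by
    refine (integral_mono hint hb hpt).trans ?_
    rw [integral_add' (h1.const_mul _) (h2.const_mul _), integral_const_mul, integral_const_mul]
    have e1 : A⁻¹ ^ (p - 1) * A = A ^ (2 - p) := by
      rw [Real.inv_rpow hA.le, ← Real.rpow_neg hA.le, ← Real.rpow_add_one hA.ne']
      ring_nf
    have e2 : A⁻¹ ^ (p - 2) = A ^ (2 - p) := by
      rw [Real.inv_rpow hA.le, ← Real.rpow_neg hA.le]
      ring_nf
    have g1 := mul_le_mul_of_nonneg_left hle (by positivity : 0 ≤ A⁻¹ ^ (p - 1))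
    have g2 := mul_le_mul_of_nonneg_left hsq (by positivity : 0 ≤ A⁻¹ ^ (p - 2))
    linarith
  have hp0' : ENNReal.ofReal p ≠ 0 := by simpa using hp0
  have hmem : MemLp f (ENNReal.ofReal p) μ := by
    rw [← integrable_norm_rpow_iff hf hp0' ENNReal.ofReal_ne_top, ENNReal.toReal_ofReal hp0.le]
    exact hint
  rw [hmem.eLpNorm_eq_integral_rpow_norm hp0' ENNReal.ofReal_ne_top, ENNReal.toReal_ofReal hp0.le]
  refine ENNReal.ofReal_le_ofReal ?_
  simp only [Real.norm_eq_abs]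
  calc (∫ x, |f x| ^ p ∂μ) ^ p⁻¹ ≤ (2 * A ^ (2 - p)) ^ p⁻¹ :=
        Real.rpow_le_rpow (integral_nonneg fun x => by positivity) hI (by positivity)
    _ = 2 ^ (1 / p) * A ^ (2 / p - 1) := by
        rw [Real.mul_rpow (by norm_num) (by positivity), ← Real.rpow_mul hA.le, one_div]
        congr 2
        field_simp

theorem stmt0 (n : ℕ) (hn : 1 ≤ n) (p : ℝ) (hp1 : 1 ≤ p) (hp2 : p ≤ 2) :
    ∃ C > (0 : ℝ), ∀ ν : Fin n → ℕ, ν ≠ 0 →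
      eLpNorm (hermiteFunPi ν) (ENNReal.ofReal p) volume ≤
        ENNReal.ofReal (C * (((∑ j, ν j : ℕ) : ℝ)) ^ (((n : ℝ) / 2) * (1 / p - 1 / 2))) := by
  refine ⟨2 ^ (1 / p) * ((3 * 3 ^ (1 / 4 : ℝ)) ^ n) ^ (2 / p - 1), by positivity, fun ν hν => ?_⟩
  set N : ℝ := ((∑ j, ν j : ℕ) : ℝ) with hN
  have hN1 : 1 ≤ N := by
    obtain ⟨j, hj⟩ := Function.ne_iff.1 hν
    have h := Finset.single_le_sum (f := ν) (fun i _ => Nat.zero_le _) (Finset.mem_univ j)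
    have hj' : ν j ≠ 0 := hj
    rw [hN]
    exact_mod_cast (Nat.one_le_iff_ne_zero.2 hj').trans h
  have hN0 : 0 < N := by linarith
  have hνN : ∀ j, (ν j : ℝ) ≤ N := fun j => by
    have h := Finset.single_le_sum (f := ν) (fun i _ => Nat.zero_le _) (Finset.mem_univ j)
    rw [hN]
    exact_mod_cast h
  have hA : ∫ x, |hermiteFunPi ν x| ≤ (3 * (3 * N) ^ (1 / 4 : ℝ)) ^ n := by
    refine (integral_abs_hermiteFunPi_le ν).trans ?_
    calc ∏ j, 3 * (2 * (ν j) + 1 : ℝ) ^ (1 / 4 : ℝ)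
        ≤ ∏ _j : Fin n, 3 * (3 * N) ^ (1 / 4 : ℝ) := by
          refine Finset.prod_le_prod (fun j _ => by positivity) fun j _ => ?_
          refine mul_le_mul_of_nonneg_left (Real.rpow_le_rpow (by positivity) ?_ (by norm_num))
            (by norm_num)
          linarith [hνN j]
      _ = _ := by simp
  refine (eLpNorm_le_of_integral_abs_le hp1 hp2
    (continuous_hermiteFunPi ν).aestronglyMeasurable (integrable_abs_hermiteFunPi ν)
    (integrable_hermiteFunPi_sq ν) (by positivity) hA (integral_hermiteFunPi_sq ν).le).trans_eq ?_
  congr 1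
  rw [Real.mul_rpow (by norm_num) hN0.le, ← mul_assoc 3, mul_pow,
    Real.mul_rpow (by positivity) (by positivity), mul_assoc, ← Real.rpow_natCast (N ^ _),
    ← Real.rpow_mul hN0.le, ← Real.rpow_mul hN0.le]
  congr 3
  ring
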